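/- For every n ≥ 6 and every c = (c_0,…,c_{n−1}) ∈ F_2^n with c_{n−1} = 0, f̂_3^n(c) = 2·(−1)^{c_{n−2}} · f̂_1^{n−3}(c^{n−3} + e_1), where c^{n−3} denotes the vector of the first n−3 coordinates of c and e_1 = (1,0,…,0) ∈ F_2^{n−3}. -/

import Mathlib

/-- Dot product on `F_2^n`. -/
def dotp (n : ℕ) (c x : Fin n → ZMod 2) : ZMod 2 := ∑ i, c i * x i

/-- Fourier transform of a Boolean function `f : F_2^n → F_2` at `c ∈ F_2^n`. -/
def walsh (n : ℕ) (f : (Fin n → ZMod 2) → ZMod 2) (c : Fin n → ZMod 2) : ℤ :=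
  ∑ x : Fin n → ZMod 2, (-1 : ℤ) ^ (f x + dotp n c x).val

/-- The rotation symmetric function `F_3^n(x) = Σ_i x_i x_{i+1 mod n} x_{i+2 mod n}`. -/
def F3 (n : ℕ) (x : Fin n → ZMod 2) : ZMod 2 :=
  ∑ i : Fin n, x i * x ⟨(i.val + 1) % n, Nat.mod_lt _ i.pos⟩
    * x ⟨(i.val + 2) % n, Nat.mod_lt _ i.pos⟩

/-- `t_m(x) = Σ_{i=0}^{m-3} x_i x_{i+1} x_{i+2}`. -/
def tm (m : ℕ) (x : Fin m → ZMod 2) : ZMod 2 :=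
  ∑ i ∈ Finset.range m,
    if h : i + 2 < m then x ⟨i, by omega⟩ * x ⟨i + 1, by omega⟩ * x ⟨i + 2, by omega⟩ else 0

/-- `f_0^m = t_m`. -/
def f0 (m : ℕ) (x : Fin m → ZMod 2) : ZMod 2 := tm m x

/-- `f_1^m = t_m + x_0 x_1`. -/
def f1 (m : ℕ) (x : Fin m → ZMod 2) : ZMod 2 :=
  if h : 2 ≤ m then tm m x + x ⟨0, by omega⟩ * x ⟨1, by omega⟩ else 0

/-- `f_2^m = t_m + x_{m-2} x_{m-1}`. -/
def f2 (m : ℕ) (x : Fin m → ZMod 2) : ZMod 2 :=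
  if h : 2 ≤ m then tm m x + x ⟨m - 2, by omega⟩ * x ⟨m - 1, by omega⟩ else 0

/-- `f_3^m = t_m + x_0 x_1 + x_{m-2} x_{m-1} + x_0 + x_{m-1}`. -/
def f3 (m : ℕ) (x : Fin m → ZMod 2) : ZMod 2 :=
  if h : 2 ≤ m then
    tm m x + x ⟨0, by omega⟩ * x ⟨1, by omega⟩ + x ⟨m - 2, by omega⟩ * x ⟨m - 1, by omega⟩
      + x ⟨0, by omega⟩ + x ⟨m - 1, by omega⟩
  else 0

/-- `c^m`: the vector of the first `m` coordinates of `c ∈ F_2^n`. -/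
def trunc {n : ℕ} (m : ℕ) (h : m ≤ n) (c : Fin n → ZMod 2) : Fin m → ZMod 2 :=
  fun i => c (Fin.castLE h i)

/-- `e_1 = (1,0,…,0) ∈ F_2^m`. -/
def eOne (m : ℕ) : Fin m → ZMod 2 := fun i => if i.val = 0 then 1 else 0

/-- `e_{2^{m-1}} = (0,…,0,1) ∈ F_2^m`. -/
def eLast (m : ℕ) : Fin m → ZMod 2 := fun i => if i.val = m - 1 then 1 else 0

/-- The weight of a Boolean function: the number of `x` with `f x = 1`. -/
def wt (n : ℕ) (f : (Fin n → ZMod 2) → ZMod 2) : ℕ :=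
  (Finset.univ.filter fun x => f x = 1).card

/-- A sum over `F_2^{m+1}` splits as a sum over `F_2^m` and the last coordinate. -/
theorem sum_snoc {M : Type*} [AddCommMonoid M] (m : ℕ) (g : (Fin (m + 1) → ZMod 2) → M) :
    ∑ x, g x = ∑ y : Fin m → ZMod 2, ∑ a : ZMod 2, g (Fin.snoc y a) := by
  rw [← (Fin.snocEquiv fun _ : Fin (m + 1) => ZMod 2).sum_comp, Fintype.sum_prod_type,
    Finset.sum_comm]
  rfl

theorem dotp_snoc (m : ℕ) (c : Fin (m + 1) → ZMod 2) (y : Fin m → ZMod 2) (a : ZMod 2) :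
    dotp (m + 1) c (Fin.snoc y a) = dotp m (fun i => c i.castSucc) y + c (Fin.last m) * a := by
  simp [dotp, Fin.sum_univ_castSucc]

theorem snoc_mk_of_lt {α : Type*} (m : ℕ) (y : Fin m → α) (a : α) (i : ℕ) (h : i < m)
    (h' : i < m + 1) : (Fin.snoc y a : Fin (m + 1) → α) ⟨i, h'⟩ = y ⟨i, h⟩ :=
  Fin.snoc_castSucc (α := fun _ => α) a y ⟨i, h⟩

theorem snoc_mk_self {α : Type*} (m : ℕ) (y : Fin m → α) (a : α) (h : m < m + 1) :
    (Fin.snoc y a : Fin (m + 1) → α) ⟨m, h⟩ = a :=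
  Fin.snoc_last (α := fun _ => α) a y

theorem tm_snoc (m : ℕ) (y : Fin (m + 2) → ZMod 2) (a : ZMod 2) :
    tm (m + 3) (Fin.snoc y a)
      = tm (m + 2) y + y ⟨m, by omega⟩ * y ⟨m + 1, by omega⟩ * a := by
  have hs : tm (m + 2) y = ∑ i ∈ Finset.range m,
      if h : i + 2 < m + 2 then
        y ⟨i, by omega⟩ * y ⟨i + 1, by omega⟩ * y ⟨i + 2, by omega⟩ else 0 := by
    simp [tm, Finset.sum_range_succ]
  rw [hs, tm, Finset.sum_range_succ, Finset.sum_range_succ, Finset.sum_range_succ,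
    dif_neg (show ¬m + 2 + 2 < m + 3 by omega), dif_neg (show ¬m + 1 + 2 < m + 3 by omega),
    dif_pos (show m + 2 < m + 3 by omega), add_zero, add_zero]
  congr 1
  · refine Finset.sum_congr rfl fun i hi => ?_
    have hi := Finset.mem_range.1 hi
    rw [dif_pos (by omega), dif_pos (by omega), snoc_mk_of_lt _ _ _ i (by omega),
      snoc_mk_of_lt _ _ _ (i + 1) (by omega), snoc_mk_of_lt _ _ _ (i + 2) (by omega)]
  · rw [snoc_mk_of_lt _ _ _ m (by omega), snoc_mk_of_lt _ _ _ (m + 1) (by omega), snoc_mk_self]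

theorem dotp_add_eOne (m : ℕ) (c y : Fin (m + 1) → ZMod 2) :
    dotp (m + 1) (c + eOne (m + 1)) y = dotp (m + 1) c y + y ⟨0, by omega⟩ := by
  simp only [dotp, eOne, Pi.add_apply, add_mul, Finset.sum_add_distrib]
  rw [Fin.sum_univ_succ (fun i : Fin (m + 1) => (if i.val = 0 then (1 : ZMod 2) else 0) * y i)]
  simp

/-- `f_3^{k+6}` after splitting off the last three coordinates. -/
theorem f3_snoc (k : ℕ) (y : Fin (k + 3) → ZMod 2) (a b d : ZMod 2) :
    f3 (k + 6) (Fin.snoc (Fin.snoc (Fin.snoc y a : Fin (k + 4) → ZMod 2) b :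
        Fin (k + 5) → ZMod 2) d)
      = f1 (k + 3) y + y ⟨0, by omega⟩ + y ⟨k + 1, by omega⟩ * y ⟨k + 2, by omega⟩ * a
        + y ⟨k + 2, by omega⟩ * a * b + a * b * d + b * d + d := by
  have e1 : k + 6 - 2 = k + 4 := by omega
  have e2 : k + 6 - 1 = k + 5 := by omega
  simp only [f3, f1, e1, e2]
  rw [dif_pos (by omega), dif_pos (by omega), tm_snoc (k + 3), tm_snoc (k + 2), tm_snoc (k + 1)]
  rw [snoc_mk_self (k + 5), snoc_mk_of_lt (k + 5) _ _ 0 (by omega),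
    snoc_mk_of_lt (k + 5) _ _ 1 (by omega), snoc_mk_of_lt (k + 5) _ _ (k + 4) (by omega),
    snoc_mk_self (k + 4), snoc_mk_of_lt (k + 4) _ _ 0 (by omega),
    snoc_mk_of_lt (k + 4) _ _ 1 (by omega), snoc_mk_of_lt (k + 4) _ _ (k + 3) (by omega),
    snoc_mk_self (k + 3), snoc_mk_of_lt (k + 3) _ _ 0 (by omega),
    snoc_mk_of_lt (k + 3) _ _ 1 (by omega), snoc_mk_of_lt (k + 3) _ _ (k + 2) (by omega)]
  ring

/-- The sum over the last three coordinates collapses to the point `a = 0`, `b = 1`. -/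
theorem sum_sign_collapse (s u v p q : ZMod 2) :
    ∑ a : ZMod 2, ∑ b : ZMod 2, ∑ d : ZMod 2,
      (-1 : ℤ) ^ (s + u * a + v * a * b + a * b * d + b * d + d + (p * a + q * b)).val
      = 2 * (-1 : ℤ) ^ q.val * (-1 : ℤ) ^ s.val := by
  revert s u v p q
  decide

/-- For every `n ≥ 6` and `c ∈ F_2^n` with `c_{n−1} = 0`,
`f̂_3^n(c) = 2(−1)^{c_{n−2}} f̂_1^{n−3}(c^{n−3} + e_1)`. -/
theorem stmt_9 (n : ℕ) (hn : 6 ≤ n) (c : Fin n → ZMod 2)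
    (hc : c ⟨n - 1, by omega⟩ = 0) :
    walsh n (f3 n) c
      = 2 * (-1 : ℤ) ^ (c ⟨n - 2, by omega⟩).val
          * walsh (n - 3) (f1 (n - 3)) (trunc (n - 3) (by omega) c + eOne (n - 3)) := by
  obtain ⟨k, rfl⟩ := Nat.exists_eq_add_of_le' hn
  change walsh (k + 6) (f3 (k + 6)) c
    = 2 * (-1 : ℤ) ^ (c ⟨k + 4, by omega⟩).val
        * walsh (k + 3) (f1 (k + 3)) (trunc (k + 3) (by omega) c + eOne (k + 3))
  have hc' : c (Fin.last (k + 5)) = 0 := hc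
  simp only [walsh]
  rw [sum_snoc (k + 5), sum_snoc (k + 4), sum_snoc (k + 3), Finset.mul_sum]
  refine Finset.sum_congr rfl fun y _ => ?_
  rw [dotp_add_eOne (k + 2), ← sum_sign_collapse _ (y ⟨k + 1, by omega⟩ * y ⟨k + 2, by omega⟩)
    (y ⟨k + 2, by omega⟩) (c ⟨k + 3, by omega⟩)]
  refine Finset.sum_congr rfl fun a _ => Finset.sum_congr rfl fun b _ =>
    Finset.sum_congr rfl fun d _ => ?_
  congr 2
  rw [f3_snoc, dotp_snoc (k + 5), dotp_snoc (k + 4), dotp_snoc (k + 3), hc']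
  change _ + (dotp (k + 3) (trunc (k + 3) (by omega) c) y + c ⟨k + 3, by omega⟩ * a
    + c ⟨k + 4, by omega⟩ * b + 0 * d) = _
  ring
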